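/- arXiv:2512.18598 — 2 statements merged into one kernel-verified Lean document; each statement's English description precedes it below -/
import Mathlib

section
/- Let d ≥ 1, let E = ℝ^d with the Euclidean inner product ⟨·,·⟩ and norm |·|, and define g : E → E by g(x) = (4|x|² − 2) x. Then: (i) g is the gradient of the double-well potential U(x) = |x|⁴ − |x|², i.e. U is differentiable with ⟨g(x), v⟩ equal to the derivative of U at x in direction v for all x, v; (ii) for all x, y ∈ E, ⟨x − y, g(x) − g(y)⟩ ≥ −2 |x − y|²; (iii) for all x, y ∈ E with |x − y| ≥ 2, ⟨x − y, g(x) − g(y)⟩ ≥ 2 |x − y|². In particular, U satisfies Assumption 2.1 with R = 2, m = 2, M = 2. -/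
open Real

theorem hasGradientAt_norm_pow_four_sub_norm_sq {E : Type*} [NormedAddCommGroup E]
    [InnerProductSpace ℝ E] [CompleteSpace E] (x : E) :
    HasGradientAt (fun z : E => ‖z‖ ^ 4 - ‖z‖ ^ 2) ((4 * ‖x‖ ^ 2 - 2) • x) x := by
  rw [hasGradientAt_iff_hasFDerivAt]
  have h : HasFDerivAt (fun z : E => ‖z‖ ^ 2) (2 • innerSL ℝ x) x :=
    (hasStrictFDerivAt_norm_sq x).hasFDerivAt
  have hfun : (fun z : E => ‖z‖ ^ 4 - ‖z‖ ^ 2) = fun z => (‖z‖ ^ 2) ^ 2 - ‖z‖ ^ 2 := by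
    ext z
    ring
  rw [hfun]
  refine ((h.pow 2).sub h).congr_fderiv ?_
  ext v
  simp
  ring

theorem real_inner_sub_norm_sq_smul_sub {E : Type*} [NormedAddCommGroup E]
    [InnerProductSpace ℝ E] (x y : E) :
    inner ℝ (x - y) (‖x‖ ^ 2 • x - ‖y‖ ^ 2 • y) =
      (‖x‖ ^ 2 + ‖y‖ ^ 2) / 2 * ‖x - y‖ ^ 2 + (‖x‖ ^ 2 - ‖y‖ ^ 2) ^ 2 / 2 := by
  rw [norm_sub_sq_real]
  simp only [inner_sub_left, inner_sub_right, real_inner_smul_right, real_inner_self_eq_norm_sq,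
    real_inner_comm x y]
  ring

theorem norm_sub_sq_le_two_mul_add {E : Type*} [NormedAddCommGroup E]
    [InnerProductSpace ℝ E] (x y : E) : ‖x - y‖ ^ 2 ≤ 2 * (‖x‖ ^ 2 + ‖y‖ ^ 2) := by
  have h := parallelogram_law_with_norm ℝ x y
  nlinarith [mul_self_nonneg ‖x + y‖]

theorem double_well_satisfies_assumption (d : ℕ) (hd : 1 ≤ d)
    (U : EuclideanSpace ℝ (Fin d) → ℝ)
    (g : EuclideanSpace ℝ (Fin d) → EuclideanSpace ℝ (Fin d))
    (hU : ∀ x, U x = ‖x‖ ^ 4 - ‖x‖ ^ 2)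
    (hg : ∀ x, g x = (4 * ‖x‖ ^ 2 - 2) • x) :
    (∀ x, HasGradientAt U (g x) x) ∧
    (∀ x y, (-2 : ℝ) * ‖x - y‖ ^ 2 ≤ (inner ℝ (x - y) (g x - g y) : ℝ)) ∧
    (∀ x y, 2 ≤ ‖x - y‖ → (2 : ℝ) * ‖x - y‖ ^ 2 ≤ (inner ℝ (x - y) (g x - g y) : ℝ)) := by
  have key (x y) : inner ℝ (x - y) (g x - g y) =
      2 * (‖x‖ ^ 2 + ‖y‖ ^ 2) * ‖x - y‖ ^ 2 + 2 * (‖x‖ ^ 2 - ‖y‖ ^ 2) ^ 2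
        - 2 * ‖x - y‖ ^ 2 := by
    have hsub : g x - g y = (4 : ℝ) • (‖x‖ ^ 2 • x - ‖y‖ ^ 2 • y) - (2 : ℝ) • (x - y) := by
      rw [hg, hg]
      module
    rw [hsub, inner_sub_right, real_inner_smul_right, real_inner_smul_right,
      real_inner_sub_norm_sq_smul_sub, real_inner_self_eq_norm_sq]
    ring
  refine ⟨fun x => ?_, fun x y => ?_, fun x y hxy => ?_⟩
  · rw [funext hU, hg]
    exact hasGradientAt_norm_pow_four_sub_norm_sq x
  · rw [key]
    have : 0 ≤ 2 * (‖x‖ ^ 2 + ‖y‖ ^ 2) * ‖x - y‖ ^ 2 + 2 * (‖x‖ ^ 2 - ‖y‖ ^ 2) ^ 2 := by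
      positivity
    linarith
  · rw [key]
    have hfar : 4 ≤ 2 * (‖x‖ ^ 2 + ‖y‖ ^ 2) := by
      nlinarith [norm_sub_sq_le_two_mul_add x y]
    have := mul_le_mul_of_nonneg_right hfar (sq_nonneg ‖x - y‖)
    linarith [sq_nonneg (‖x‖ ^ 2 - ‖y‖ ^ 2)]
end

section
/- Let d ≥ 1 and let U : ℝ^d → ℝ be twice continuously differentiable. Suppose there are r₀ ≥ 0, κ > 0 and L ≥ 0 such that the Hessian of U satisfies ⟨v, ∇²U(x) v⟩ ≥ κ|v|² for every x with |x| ≥ r₀ and every v ∈ ℝ^d, and ⟨v, ∇²U(x) v⟩ ≥ −L|v|² for every x, v ∈ ℝ^d. Then there exist R > 0 and M ≥ m > 0 such that for all x, y ∈ ℝ^d: ⟨x − y, ∇U(x) − ∇U(y)⟩ ≥ −M|x − y|², and if |x − y| > R then ⟨x − y, ∇U(x) − ∇U(y)⟩ ≥ m|x − y|². -/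
open Real

section

open MeasureTheory

variable {E : Type*} [NormedAddCommGroup E]

theorem volume_line_inter_ball_le [NormedSpace ℝ E] (y : E) {v : E} (hv : v ≠ 0) (r : ℝ) :
    volume {t : ℝ | ‖y + t • v‖ < r} ≤ ENNReal.ofReal (2 * r / ‖v‖) := by
  have hv' : 0 < ‖v‖ := norm_pos_iff.2 hv
  refine (Real.volume_le_diam _).trans (Metric.ediam_le fun s hs t ht => ?_)
  rw [edist_dist, Real.dist_eq]
  refine ENNReal.ofReal_le_ofReal ?_
  rw [le_div_iff₀ hv', ← Real.norm_eq_abs, ← norm_smul]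
  calc ‖(s - t) • v‖ = ‖(y + s • v) - (y + t • v)‖ := by congr 1; module
    _ ≤ ‖y + s • v‖ + ‖y + t • v‖ := norm_sub_le _ _
    _ ≤ 2 * r := by linarith [show ‖y + s • v‖ < r from hs, show ‖y + t • v‖ < r from ht]

theorem continuous_iteratedFDeriv_two_line [NormedSpace ℝ E] {U : E → ℝ} (hU : ContDiff ℝ 2 U)
    (y v : E) : Continuous fun t : ℝ => iteratedFDeriv ℝ 2 U (y + t • v) ![v, v] := by
  have h : Continuous (iteratedFDeriv ℝ 2 U) := hU.continuous_iteratedFDeriv le_rfl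
  exact (ContinuousMultilinearMap.apply ℝ (fun _ : Fin 2 => E) ℝ ![v, v]).continuous.comp
    (h.comp (by fun_prop))

theorem inner_sub_gradient_sub_eq_integral [InnerProductSpace ℝ E] [CompleteSpace E] {U : E → ℝ}
    (hU : ContDiff ℝ 2 U) (x y : E) :
    inner ℝ (x - y) (gradient U x - gradient U y) =
      ∫ t in (0 : ℝ)..1, iteratedFDeriv ℝ 2 U (y + t • (x - y)) ![x - y, x - y] := by
  have hderiv (t : ℝ) : HasDerivAt (fun t : ℝ => fderiv ℝ U (y + t • (x - y)) (x - y))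
      (iteratedFDeriv ℝ 2 U (y + t • (x - y)) ![x - y, x - y]) t := by
    have hline : HasDerivAt (fun t : ℝ => y + t • (x - y)) (x - y) t := by
      simpa using ((hasDerivAt_id t).smul_const (x - y)).const_add y
    have hdiff : DifferentiableAt ℝ (fderiv ℝ U) (y + t • (x - y)) :=
      (hU.fderiv_right (m := 1) (by norm_num)).differentiable (by norm_num) _
    have hcomp : HasDerivAt (fun t : ℝ => fderiv ℝ U (y + t • (x - y)))
        (fderiv ℝ (fderiv ℝ U) (y + t • (x - y)) (x - y)) t :=
      hdiff.hasFDerivAt.comp_hasDerivAt t hline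
    rw [iteratedFDeriv_two_apply]
    simpa using hcomp.clm_apply (hasDerivAt_const t (x - y))
  rw [intervalIntegral.integral_eq_sub_of_hasDerivAt (fun t _ => hderiv t)
    ((continuous_iteratedFDeriv_two_line hU y (x - y)).intervalIntegrable 0 1)]
  rw [real_inner_comm, inner_sub_left]
  simp [gradient, -map_sub]

theorem le_inner_sub_gradient_sub [InnerProductSpace ℝ E] [CompleteSpace E] {U : E → ℝ}
    (hU : ContDiff ℝ 2 U) {c : ℝ} (h : ∀ x v : E, c * ‖v‖ ^ 2 ≤ iteratedFDeriv ℝ 2 U x ![v, v])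
    (x y : E) : c * ‖x - y‖ ^ 2 ≤ inner ℝ (x - y) (gradient U x - gradient U y) := by
  rw [inner_sub_gradient_sub_eq_integral hU]
  have := intervalIntegral.integral_mono_on (μ := volume) zero_le_one
    (intervalIntegrable_const (c := c * ‖x - y‖ ^ 2))
    ((continuous_iteratedFDeriv_two_line hU y (x - y)).intervalIntegrable 0 1)
    fun t _ => h (y + t • (x - y)) (x - y)
  simpa using this

theorem le_inner_sub_gradient_sub_of_convex_outside_ball [InnerProductSpace ℝ E]
    [CompleteSpace E] {U : E → ℝ} (hU : ContDiff ℝ 2 U) {r κ L : ℝ} (hr : 0 ≤ r)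
    (hκL : 0 ≤ κ + L)
    (hfar : ∀ x : E, r ≤ ‖x‖ → ∀ v : E, κ * ‖v‖ ^ 2 ≤ iteratedFDeriv ℝ 2 U x ![v, v])
    (hglob : ∀ x v : E, -L * ‖v‖ ^ 2 ≤ iteratedFDeriv ℝ 2 U x ![v, v])
    {x y : E} (hxy : x ≠ y) :
    (κ - (κ + L) * (2 * r / ‖x - y‖)) * ‖x - y‖ ^ 2 ≤
      inner ℝ (x - y) (gradient U x - gradient U y) := by
  rw [inner_sub_gradient_sub_eq_integral hU]
  set v := x - y
  set S : Set ℝ := {t | ‖y + t • v‖ < r}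
  have hSm : MeasurableSet S := (isOpen_lt (by fun_prop) continuous_const).measurableSet
  have hSvol : volume S ≤ ENNReal.ofReal (2 * r / ‖v‖) :=
    volume_line_inter_ball_le y (sub_ne_zero.2 hxy) r
  have hind : IntervalIntegrable (S.indicator fun _ => (κ + L) * ‖v‖ ^ 2) volume 0 1 := by
    rw [intervalIntegrable_iff]
    exact (intervalIntegrable_iff.1 intervalIntegrable_const).indicator hSm
  have hint : ∫ t in (0 : ℝ)..1, (κ * ‖v‖ ^ 2 - S.indicator (fun _ => (κ + L) * ‖v‖ ^ 2) t) =
      κ * ‖v‖ ^ 2 - volume.real (S ∩ Set.Ioc 0 1) * ((κ + L) * ‖v‖ ^ 2) := by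
    rw [intervalIntegral.integral_sub intervalIntegrable_const hind,
      intervalIntegral.integral_of_le (f := S.indicator _) zero_le_one,
      integral_indicator_const _ hSm, measureReal_restrict_apply hSm]
    simp
  calc (κ - (κ + L) * (2 * r / ‖v‖)) * ‖v‖ ^ 2
      = κ * ‖v‖ ^ 2 - 2 * r / ‖v‖ * ((κ + L) * ‖v‖ ^ 2) := by ring
    _ ≤ κ * ‖v‖ ^ 2 - volume.real (S ∩ Set.Ioc 0 1) * ((κ + L) * ‖v‖ ^ 2) := by
      gcongr
      exact ENNReal.toReal_le_of_le_ofReal (by positivity)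
        ((measure_mono Set.inter_subset_left).trans hSvol)
    _ ≤ ∫ t in (0 : ℝ)..1, iteratedFDeriv ℝ 2 U (y + t • v) ![v, v] := by
      rw [← hint]
      refine intervalIntegral.integral_mono_on zero_le_one (intervalIntegrable_const.sub hind)
        ((continuous_iteratedFDeriv_two_line hU y v).intervalIntegrable 0 1) fun t _ => ?_
      by_cases ht : t ∈ S
      · rw [Set.indicator_of_mem ht]
        linarith [hglob (y + t • v) v]
      · rw [Set.indicator_of_notMem ht, sub_zero]
        exact hfar _ (not_lt.1 ht) v

end

theorem convex_outside_compact_implies_assumption (d : ℕ) (hd : 1 ≤ d)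
    (U : EuclideanSpace ℝ (Fin d) → ℝ) (hU : ContDiff ℝ 2 U)
    (r₀ κ L : ℝ) (hr₀ : 0 ≤ r₀) (hκ : 0 < κ) (hL : 0 ≤ L)
    (hfar : ∀ x : EuclideanSpace ℝ (Fin d), r₀ ≤ ‖x‖ →
      ∀ v : EuclideanSpace ℝ (Fin d), κ * ‖v‖ ^ 2 ≤ iteratedFDeriv ℝ 2 U x ![v, v])
    (hglob : ∀ x v : EuclideanSpace ℝ (Fin d),
      -L * ‖v‖ ^ 2 ≤ iteratedFDeriv ℝ 2 U x ![v, v]) :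
    ∃ R m M : ℝ, 0 < R ∧ 0 < m ∧ m ≤ M ∧
      ∀ x y : EuclideanSpace ℝ (Fin d),
        (-M * ‖x - y‖ ^ 2 ≤ (inner ℝ (x - y) (gradient U x - gradient U y) : ℝ)) ∧
        (R < ‖x - y‖ → m * ‖x - y‖ ^ 2 ≤ (inner ℝ (x - y) (gradient U x - gradient U y) : ℝ)) := by
  have hκL : 0 ≤ κ + L := by positivity
  refine ⟨4 * r₀ * (κ + L) / κ + 1, κ / 2, max L (κ / 2), by positivity, by positivity,
    le_max_right _ _, fun x y => ⟨?_, fun hR => ?_⟩⟩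
  · refine le_trans ?_ (le_inner_sub_gradient_sub hU hglob x y)
    gcongr
    exact le_max_left _ _
  · have hpos : 0 < ‖x - y‖ := lt_trans (by positivity) hR
    refine le_trans ?_ (le_inner_sub_gradient_sub_of_convex_outside_ball hU hr₀ hκL hfar hglob
      (sub_ne_zero.1 (norm_pos_iff.1 hpos)))
    gcongr
    have hR' : 4 * r₀ * (κ + L) / κ ≤ ‖x - y‖ := by linarith
    rw [div_le_iff₀ hκ] at hR'
    have : (κ + L) * (2 * r₀ / ‖x - y‖) ≤ κ / 2 := by
      rw [← mul_div_assoc, div_le_iff₀ hpos]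
      linarith
    linarith
end
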